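/- Every directed cycle is avoidable: for every ℓ ≥ 2 there exists a function d : ℕ → ℕ such that for every k, every digraph of minimum out-degree at least d(k) contains a subdigraph of minimum out-degree at least k that contains no directed cycle of length ℓ. -/

import Mathlib

/-- A digraph: a set of vertices together with arcs (ordered pairs of
distinct vertices) between them, inside an ambient vertex type `α`. -/
structure Digraph' (α : Type) where
  verts : Set α
  Adj : α → α → Prop
  ne_of_adj : ∀ ⦃u v : α⦄, Adj u v → u ≠ v
  mem_verts_left : ∀ ⦃u v : α⦄, Adj u v → u ∈ verts
  mem_verts_right : ∀ ⦃u v : α⦄, Adj u v → v ∈ verts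

namespace Digraph'

variable {α β : Type}

/-- The out-neighbourhood of a vertex. -/
def outNbrs (D : Digraph' α) (v : α) : Set α := {u | D.Adj v u}

/-- The in-neighbourhood of a vertex. -/
def inNbrs (D : Digraph' α) (v : α) : Set α := {u | D.Adj u v}

/-- The set `s` has at least `k` elements (also meaningful for infinite sets). -/
def AtLeast (s : Set α) (k : ℕ) : Prop := ∃ t : Finset α, ↑t ⊆ s ∧ k ≤ t.card

/-- Every vertex of `D` has out-degree at least `k`, i.e. `δ⁺(D) ≥ k`. -/
def MinOutDegAtLeast (D : Digraph' α) (k : ℕ) : Prop :=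
  ∀ v ∈ D.verts, AtLeast (D.outNbrs v) k

/-- `D'` is a subdigraph of `D`. -/
def IsSubdigraph (D' D : Digraph' α) : Prop :=
  D'.verts ⊆ D.verts ∧ ∀ ⦃u v : α⦄, D'.Adj u v → D.Adj u v

/-- `D` contains a copy of the pattern digraph `F` (a pattern digraph has
vertex set all of its ambient type). -/
def HasCopy (D : Digraph' α) (F : Digraph' β) : Prop :=
  ∃ f : β → α, Function.Injective f ∧ (∀ w : β, f w ∈ D.verts) ∧
    ∀ ⦃u v : β⦄, F.Adj u v → D.Adj (f u) (f v)

/-- The digraph `F` is avoidable: there is `d_F : ℕ → ℕ` such that every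
(nonempty) digraph of minimum out-degree at least `d_F k` contains an
`F`-free subdigraph of minimum out-degree at least `k`. -/
def Avoidable (F : Digraph' β) : Prop :=
  ∃ dF : ℕ → ℕ, ∀ (α : Type) (D : Digraph' α) (k : ℕ), D.verts.Nonempty →
    D.MinOutDegAtLeast (dF k) →
    ∃ D' : Digraph' α, D'.IsSubdigraph D ∧ D'.verts.Nonempty ∧
      D'.MinOutDegAtLeast k ∧ ¬ D'.HasCopy F

end Digraph'

open Digraph'

/-- `D` contains a directed cycle of length `n`: distinct vertices
`v_0, …, v_{n-1}` with arcs `(v_i, v_{i+1 mod n})`. -/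
def HasDirCycle {α : Type} (D : Digraph' α) (n : ℕ) : Prop :=
  ∃ f : ℕ → α, (∀ i j, i < n → j < n → f i = f j → i = j) ∧
    ∀ i, i < n → D.Adj (f i) (f ((i + 1) % n))


section LLL
open Finset

/-- `f` matches the partial assignment `B`. -/
def Matches {σ : Type} {m : ℕ} (f : σ → Fin m) (B : Finset (σ × Fin m)) : Prop :=
  ∀ x ∈ B, f x.1 = x.2

open Classical in
/-- Assignments avoiding all bad partial assignments supported in `U`. -/
noncomputable def Good {σ : Type} [Fintype σ] {m : ℕ} (BB : Set (Finset (σ × Fin m)))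
    (U : Finset σ) : Finset (σ → Fin m) :=
  Finset.univ.filter fun f => ∀ B ∈ BB, B.image Prod.fst ⊆ U → ¬ Matches f B

open Classical in
lemma indep_one {σ : Type} [Fintype σ] {m : ℕ} (Y : Finset (σ → Fin m)) (s : σ) (t : Fin m)
    (hY : ∀ f ∈ Y, ∀ t', Function.update f s t' ∈ Y) :
    (Y.filter fun f => f s = t).card * m ≤ Y.card := by
  have h : ((Y.filter fun f => f s = t) ×ˢ (Finset.univ : Finset (Fin m))).card ≤ Y.card := by
    apply Finset.card_le_card_of_injOn (fun p => Function.update p.1 s p.2)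
    · rintro ⟨f, t'⟩ h
      simp at h
      exact hY f h.1 t'
    · rintro ⟨f, t1⟩ hf ⟨g, t2⟩ hg h
      simp at hf hg h
      have h1 : t1 = t2 := by simpa using congrFun h s
      refine Prod.ext ?_ h1
      funext x
      by_cases hx : x = s
      · subst hx; simp [hf.2, hg.2]
      · simpa [hx] using congrFun h x
  simpa using h

open Classical in
lemma indep_many {σ : Type} [Fintype σ] {m : ℕ} (X : Finset (σ → Fin m))
    (B : Finset (σ × Fin m)) (hB : Set.InjOn Prod.fst (B : Set (σ × Fin m)))
    (hX : ∀ f ∈ X, ∀ s ∈ B.image Prod.fst, ∀ t', Function.update f s t' ∈ X) :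
    (X.filter fun f => Matches f B).card * m ^ B.card ≤ X.card := by
  induction B using Finset.induction_on with
  | empty => simpa using Finset.card_filter_le _ _
  | insert x B hx ih =>
    have ih' := ih (hB.mono (by simp)) (fun f hf s hs => hX f hf s (by
      rw [Finset.image_insert]; exact Finset.mem_insert_of_mem hs))
    rw [Finset.card_insert_of_notMem hx, pow_succ', ← mul_assoc]
    refine le_trans (Nat.mul_le_mul_right _ ?_) ih'
    have h1 := indep_one (X.filter fun f => Matches f B) x.1 x.2 (by
      intro f hf t'
      simp only [Finset.mem_filter] at hf ⊢
      refine ⟨hX f hf.1 _ (by simp) t', ?_⟩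
      intro y hy
      have hne : y.1 ≠ x.1 := by
        intro h
        have := hB (by simp [hy]) (by simp) h
        exact hx (this ▸ hy)
      rw [Function.update_of_ne hne]
      exact hf.2 y hy)
    refine le_trans (le_of_eq ?_) h1
    congr 2
    ext f
    rw [Finset.mem_filter, Finset.mem_filter, Finset.mem_filter]
    simp only [Matches, Finset.mem_insert, forall_eq_or_imp]
    tauto

lemma chain {σ : Type} [DecidableEq σ] (g : Finset σ → ℕ) (n : ℕ)
    (h : ∀ U : Finset σ, U.card < n → ∀ s ∉ U, g U ≤ 2 * g (insert s U)) :
    ∀ (R W : Finset σ), Disjoint W R → (W ∪ R).card ≤ n → g W ≤ 2 ^ R.card * g (W ∪ R) := by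
  intro R
  induction R using Finset.induction_on with
  | empty => intro W; simp
  | insert s R hs ih =>
    intro W hd hc
    rw [Finset.disjoint_insert_right] at hd
    have hnot : s ∉ W ∪ R := by simp [hd.1, hs]
    rw [Finset.union_insert] at hc ⊢
    rw [Finset.card_insert_of_notMem hnot] at hc
    rw [Finset.card_insert_of_notMem hs, pow_succ, mul_assoc]
    exact (ih W hd.2 (by omega)).trans (Nat.mul_le_mul_left _ (h _ (by omega) s hnot))

open Classical in
lemma lll_step {σ : Type} [Fintype σ] {m ℓ M : ℕ} (hm : 0 < m)
    (BB : Set (Finset (σ × Fin m)))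
    (hcard : ∀ B ∈ BB, B.card = ℓ)
    (hinj : ∀ B ∈ BB, Set.InjOn Prod.fst (B : Set (σ × Fin m)))
    (hdeg : ∀ s : σ, ∃ F : Finset (Finset (σ × Fin m)), F.card ≤ M ∧
      ∀ B ∈ BB, s ∈ B.image Prod.fst → B ∈ F)
    (hM : M * 2 ^ ℓ ≤ m ^ ℓ) (n : ℕ) :
    ∀ U : Finset σ, U.card = n → ∀ s ∉ U,
      (Good BB U).card ≤ 2 * (Good BB (insert s U)).card := by
  induction n using Nat.strong_induction_on with
  | _ n IH =>
  intro U hU s hs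
  obtain ⟨F, hF, hFB⟩ := hdeg s
  set F' := F.filter (fun B => B ∈ BB ∧ s ∈ B.image Prod.fst) with hF'
  have hF'c : F'.card ≤ M := (Finset.card_filter_le _ _).trans hF
  have hcov : Good BB U ⊆ Good BB (insert s U) ∪
      F'.biUnion (fun B => (Good BB (U \ B.image Prod.fst)).filter fun f => Matches f B) := by
    intro f hf
    by_cases h : f ∈ Good BB (insert s U)
    · exact Finset.mem_union_left _ h
    · apply Finset.mem_union_right
      simp only [Good, Finset.mem_filter, Finset.mem_univ, true_and, not_forall, not_not] at h hf
      obtain ⟨B, hB, hBU, hBm⟩ := h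
      have hsB : s ∈ B.image Prod.fst := by
        by_contra hsB
        refine hf B hB (fun x hx => ?_) hBm
        rcases Finset.mem_insert.1 (hBU hx) with h | h
        · exact absurd (h ▸ hx) hsB
        · exact h
      rw [Finset.mem_biUnion]
      refine ⟨B, ?_, ?_⟩
      · rw [hF', Finset.mem_filter]; exact ⟨hFB B hB hsB, hB, hsB⟩
      · simp only [Good, Finset.mem_filter, Finset.mem_univ, true_and]
        exact ⟨fun B' hB' h' => hf B' hB' (h'.trans Finset.sdiff_subset), hBm⟩
  have hbound : ∀ B ∈ F', 2 * (((Good BB (U \ B.image Prod.fst)).filter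
      fun f => Matches f B).card * m ^ ℓ) ≤ 2 ^ ℓ * (Good BB U).card := by
    intro B hBF
    obtain ⟨-, hB, hsB⟩ := Finset.mem_filter.1 hBF
    have h1 := indep_many (Good BB (U \ B.image Prod.fst)) B (hinj B hB) (by
      intro f hf x hx t'
      simp only [Good, Finset.mem_filter, Finset.mem_univ, true_and] at hf ⊢
      intro B' hB' hsub hmt
      refine hf B' hB' hsub (fun y hy => ?_)
      have hy' := hsub (Finset.mem_image_of_mem Prod.fst hy)
      have hne : y.1 ≠ x := by
        rintro rfl
        exact (Finset.mem_sdiff.1 hy').2 hx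
      have := hmt y hy
      rwa [Function.update_of_ne hne] at this)
    rw [hcard B hB] at h1
    have h2 := chain (fun U => (Good BB U).card) n (fun U' hU' => IH U'.card hU' U' rfl)
      (U ∩ B.image Prod.fst) (U \ B.image Prod.fst)
      (Finset.disjoint_sdiff_inter _ _) (by rw [Finset.sdiff_union_inter, hU])
    rw [Finset.sdiff_union_inter] at h2
    have h3 : (U ∩ B.image Prod.fst).card + 1 ≤ ℓ := by
      rw [← hcard B hB, ← Finset.card_image_of_injOn (hinj B hB),
        ← Finset.card_insert_of_notMem (a := s) (s := U ∩ B.image Prod.fst)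
          (fun h => hs (Finset.mem_inter.1 h).1)]
      apply Finset.card_le_card
      intro x hx
      rcases Finset.mem_insert.1 hx with h | h
      · exact h ▸ hsB
      · exact (Finset.mem_inter.1 h).2
    calc _ ≤ 2 * (2 ^ (U ∩ B.image Prod.fst).card * (Good BB U).card) :=
          Nat.mul_le_mul_left _ (h1.trans h2)
      _ = 2 ^ ((U ∩ B.image Prod.fst).card + 1) * (Good BB U).card := by ring
      _ ≤ _ := Nat.mul_le_mul_right _ (Nat.pow_le_pow_right (by norm_num) h3)
  have hsum : 2 * ((F'.biUnion (fun B => (Good BB (U \ B.image Prod.fst)).filter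
      fun f => Matches f B)).card * m ^ ℓ) ≤ m ^ ℓ * (Good BB U).card := by
    calc _ ≤ 2 * ((∑ B ∈ F', ((Good BB (U \ B.image Prod.fst)).filter
            fun f => Matches f B).card) * m ^ ℓ) := by
          gcongr; exact Finset.card_biUnion_le
      _ = ∑ B ∈ F', 2 * (((Good BB (U \ B.image Prod.fst)).filter
            fun f => Matches f B).card * m ^ ℓ) := by
          rw [Finset.sum_mul, Finset.mul_sum]
      _ ≤ F'.card • (2 ^ ℓ * (Good BB U).card) := Finset.sum_le_card_nsmul _ _ _ hbound
      _ ≤ M * (2 ^ ℓ * (Good BB U).card) := by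
          rw [smul_eq_mul]; gcongr
      _ ≤ _ := by rw [← mul_assoc]; gcongr
  have hc := (Finset.card_le_card hcov).trans (Finset.card_union_le _ _)
  have hpos : 0 < m ^ ℓ := Nat.pow_pos hm
  have h4 : 2 * (F'.biUnion (fun B => (Good BB (U \ B.image Prod.fst)).filter
      fun f => Matches f B)).card ≤ (Good BB U).card := by
    apply Nat.le_of_mul_le_mul_left _ hpos
    calc _ = _ := by ring
      _ ≤ _ := hsum
  omega

open Classical in
lemma lll_finite {σ : Type} [Fintype σ] {m ℓ M : ℕ} (hm : 0 < m) (hℓ : 0 < ℓ)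
    (BB : Set (Finset (σ × Fin m)))
    (hcard : ∀ B ∈ BB, B.card = ℓ)
    (hinj : ∀ B ∈ BB, Set.InjOn Prod.fst (B : Set (σ × Fin m)))
    (hdeg : ∀ s : σ, ∃ F : Finset (Finset (σ × Fin m)), F.card ≤ M ∧
      ∀ B ∈ BB, (∃ x ∈ B, x.1 = s) → B ∈ F)
    (hM : M * 2 ^ ℓ ≤ m ^ ℓ) :
    ∃ f : σ → Fin m, ∀ B ∈ BB, ¬ Matches f B := by
  have hdeg' : ∀ s : σ, ∃ F : Finset (Finset (σ × Fin m)), F.card ≤ M ∧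
      ∀ B ∈ BB, s ∈ B.image Prod.fst → B ∈ F := by
    intro s
    obtain ⟨F, hF, hFB⟩ := hdeg s
    exact ⟨F, hF, fun B hB hs => hFB B hB (Finset.mem_image.1 hs)⟩
  have h := chain (fun U => (Good BB U).card) (Fintype.card σ)
    (fun U _ => lll_step hm BB hcard hinj hdeg' hM U.card U rfl) Finset.univ ∅
    (by simp) (by simp [Finset.card_univ])
  have h0 : 0 < (Good BB ∅).card := by
    rw [Finset.card_pos]
    refine ⟨fun _ => ⟨0, hm⟩, ?_⟩
    simp only [Good, Finset.mem_filter, Finset.mem_univ, true_and]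
    intro B hB hsub
    exfalso
    have : B = ∅ := by simpa using hsub
    have h2 := hcard B hB
    rw [this, Finset.card_empty] at h2
    omega
  have h1 : 0 < (Good BB Finset.univ).card := by
    rw [Finset.empty_union] at h
    by_contra hcon
    have : (Good BB Finset.univ).card = 0 := by omega
    simp only [this] at h
    omega
  obtain ⟨f, hf⟩ := Finset.card_pos.1 h1
  simp only [Good, Finset.mem_filter, Finset.mem_univ, true_and] at hf
  exact ⟨f, fun B hB => hf B hB (Finset.subset_univ _)⟩

open Classical in
lemma lll {σ : Type} {m ℓ M : ℕ} (hm : 0 < m) (hℓ : 0 < ℓ)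
    (BB : Set (Finset (σ × Fin m)))
    (hcard : ∀ B ∈ BB, B.card = ℓ)
    (hinj : ∀ B ∈ BB, Set.InjOn Prod.fst (B : Set (σ × Fin m)))
    (hdeg : ∀ s : σ, ∃ F : Finset (Finset (σ × Fin m)), F.card ≤ M ∧
      ∀ B ∈ BB, (∃ x ∈ B, x.1 = s) → B ∈ F)
    (hM : M * 2 ^ ℓ ≤ m ^ ℓ) :
    ∃ f : σ → Fin m, ∀ B ∈ BB, ¬ Matches f B := by
  have hfin : ∀ T : Finset σ, ∃ f : σ → Fin m, ∀ B ∈ BB, B.image Prod.fst ⊆ T →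
      ¬ Matches f B := by
    intro T
    let e : (T × Fin m) ↪ (σ × Fin m) :=
      ⟨fun x => (x.1.1, x.2), by
        rintro ⟨⟨a, _⟩, b⟩ ⟨⟨c, _⟩, d⟩ h
        simpa using h⟩
    obtain ⟨f, hf⟩ := lll_finite (σ := T) (M := M) hm hℓ {B | B.map e ∈ BB}
      (fun B hB => by rw [← hcard _ hB, Finset.card_map])
      (fun B hB x hx y hy hxy => by
        apply e.injective
        apply hinj _ hB
        · simpa using hx
        · simpa using hy
        · exact congrArg Subtype.val hxy)
      (fun s => by
        obtain ⟨F, hF, hFB⟩ := hdeg s.1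
        refine ⟨F.preimage (fun B => B.map e) (Finset.map_injective e).injOn, ?_, ?_⟩
        · refine le_trans ?_ hF
          apply Finset.card_le_card_of_injOn (fun B => B.map e)
          · intro B hB; simpa using hB
          · exact (Finset.map_injective e).injOn
        · intro B hB hs
          rw [Finset.mem_preimage]
          apply hFB _ hB
          obtain ⟨x, hx, rfl⟩ := hs
          exact ⟨e x, Finset.mem_map_of_mem e hx, rfl⟩)
      hM
    refine ⟨fun x => if h : x ∈ T then f ⟨x, h⟩ else ⟨0, hm⟩, fun B hB hBT hmt => ?_⟩
    have hr : ∃ B' : Finset (T × Fin m), B'.map e = B := by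
      refine ⟨B.preimage e e.injective.injOn, ?_⟩
      ext x
      simp only [Finset.mem_map, Finset.mem_preimage]
      constructor
      · rintro ⟨a, ha, rfl⟩; exact ha
      · intro hx
        exact ⟨(⟨x.1, hBT (Finset.mem_image_of_mem _ hx)⟩, x.2), hx, rfl⟩
    obtain ⟨B', rfl⟩ := hr
    refine hf B' hB (fun x hx => ?_)
    have := hmt (e x) (Finset.mem_map_of_mem e hx)
    have h2 : (if h : x.1.1 ∈ T then f ⟨x.1.1, h⟩ else ⟨0, hm⟩) = x.2 := this
    rw [dif_pos x.1.2] at h2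
    exact h2
  have hc := isCompact_univ.inter_iInter_nonempty (X := σ → Fin m)
    (fun B : BB => {f : σ → Fin m | ¬ Matches f B.1})
    (fun B => by
      have : {f : σ → Fin m | ¬ Matches f B.1} =
          (⋂ x ∈ B.1, {f : σ → Fin m | f x.1 = x.2})ᶜ := by
        ext f; simp [Matches]
      rw [this, isClosed_compl_iff]
      apply isOpen_biInter_finset
      intro x _
      exact (isOpen_discrete ({x.2} : Set (Fin m))).preimage
        (continuous_apply (A := fun _ : σ => Fin m) x.1))
    (fun u => by
      obtain ⟨f, hf⟩ := hfin (u.biUnion fun B => B.1.image Prod.fst)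
      refine ⟨f, Set.mem_univ _, ?_⟩
      simp only [Set.mem_iInter]
      intro B hB
      exact hf B.1 B.2 (Finset.subset_biUnion_of_mem (fun B : BB => B.1.image Prod.fst) hB))
  obtain ⟨f, -, hf⟩ := hc
  simp only [Set.mem_iInter] at hf
  exact ⟨f, fun B hB => hf ⟨B, hB⟩⟩

end LLL

section Cycles

/-- Walk from `v0` following the choices `q`. -/
def walkOf {V P : Type} (N : V → P → V) (v0 : V) (q : ℕ → P) : ℕ → V
  | 0 => v0
  | n + 1 => N (walkOf N v0 q n) (q n)

open Classical in
/-- The partial assignment coming from a closed walk. -/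
noncomputable def pat {V : Type} {k m : ℕ} (ℓ : ℕ) (v : ℕ → V) (p : ℕ → Fin k × Fin m) :
    Finset ((V × Fin k) × Fin m) :=
  (Finset.range ℓ).image fun i => ((v i, (p i).1), (p i).2)

/-- All patterns of `ℓ`-cycles. -/
def cyc {V : Type} {k m : ℕ} (N : V → Fin k × Fin m → V) (ℓ : ℕ) :
    Set (Finset ((V × Fin k) × Fin m)) :=
  {B | ∃ (v : ℕ → V) (p : ℕ → Fin k × Fin m), (∀ i, v (i + ℓ) = v i) ∧
    (∀ i, p (i + ℓ) = p i) ∧ (∀ i j, i < ℓ → j < ℓ → v i = v j → i = j) ∧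
    (∀ i, N (v i) (p i) = v (i + 1)) ∧ B = pat ℓ v p}

lemma pat_shift {V : Type} {k m ℓ : ℕ} (hℓ : 0 < ℓ) (v : ℕ → V) (p : ℕ → Fin k × Fin m)
    (hv : ∀ i, v (i + ℓ) = v i) (hp : ∀ i, p (i + ℓ) = p i) (r : ℕ) :
    pat ℓ (fun i => v (i + r)) (fun i => p (i + r)) = pat ℓ v p := by
  classical
  induction r with
  | zero => rfl
  | succ r ih =>
    rw [← ih]
    ext x
    simp only [pat, Finset.mem_image, Finset.mem_range]
    constructor
    · rintro ⟨i, hi, rfl⟩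
      by_cases h : i + 1 < ℓ
      · exact ⟨i + 1, h, by rw [show i + (r + 1) = i + 1 + r by ring]⟩
      · refine ⟨0, hℓ, ?_⟩
        rw [show i + (r + 1) = 0 + r + ℓ by omega, hv, hp]
    · rintro ⟨i, hi, rfl⟩
      rcases i with _ | i
      · refine ⟨ℓ - 1, by omega, ?_⟩
        rw [show ℓ - 1 + (r + 1) = 0 + r + ℓ by omega, hv, hp]
      · exact ⟨i, by omega, by rw [show i + (r + 1) = i + 1 + r by ring]⟩

lemma cyc_deg {V : Type} {k m ℓ : ℕ} (hℓ : 0 < ℓ) (N : V → Fin k × Fin m → V)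
    (hN : ∀ v, Function.Injective (N v)) (s : V × Fin k) :
    ∃ F : Finset (Finset ((V × Fin k) × Fin m)), F.card ≤ (k * m) ^ (ℓ - 1) ∧
      ∀ B ∈ cyc N ℓ, (∃ x ∈ B, x.1 = s) → B ∈ F := by
  classical
  by_cases hP : Nonempty (Fin k × Fin m)
  swap
  · refine ⟨∅, by simp, ?_⟩
    rintro B ⟨v, p, -⟩
    exact absurd ⟨p 0⟩ hP
  let ext : (Fin (ℓ - 1) → Fin k × Fin m) → ℕ → Fin k × Fin m :=
    fun q i => if h : i < ℓ - 1 then q ⟨i, h⟩ else Classical.choice hP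
  let Φ : (Fin (ℓ - 1) → Fin k × Fin m) → Finset ((V × Fin k) × Fin m) := fun q =>
    pat ℓ (walkOf N s.1 (ext q)) (fun i => if i < ℓ - 1 then ext q i else
      Function.invFun (N (walkOf N s.1 (ext q) i)) s.1)
  refine ⟨Finset.univ.image Φ, ?_, ?_⟩
  · refine Finset.card_image_le.trans ?_
    simp
  · rintro B ⟨v, p, hv, hp, hvi, hvp, rfl⟩ ⟨x, hx, rfl⟩
    simp only [pat, Finset.mem_image, Finset.mem_range] at hx
    obtain ⟨r, hr, rfl⟩ := hx
    rw [← pat_shift hℓ v p hv hp r]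
    rw [Finset.mem_image]
    refine ⟨fun i => p (i + r), Finset.mem_univ _, ?_⟩
    have hw : ∀ i, i < ℓ → walkOf N (v r) (ext fun i => p (i + r)) i = v (i + r) := by
      intro i
      induction i with
      | zero => intro _; simp [walkOf]
      | succ i ih =>
        intro hi
        rw [walkOf, ih (by omega)]
        simp only [ext]
        rw [dif_pos (by omega), hvp]
        congr 1; ring
    simp only [Φ, pat]
    apply Finset.image_congr
    intro i hi
    have hi : i < ℓ := by simpa using hi
    have hq : (if i < ℓ - 1 then ext (fun i => p (i + r)) i else
      Function.invFun (N (walkOf N (v r) (ext (fun i => p (i + r))) i)) (v r)) = p (i + r) := by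
      split_ifs with h
      · simp [ext, h]
      · rw [hw i hi]
        have : v r = N (v (i + r)) (p (i + r)) := by
          rw [hvp, show i + r + 1 = r + ℓ by omega, hv]
        rw [this]
        exact Function.leftInverse_invFun (hN _) _
    dsimp only
    rw [hq, hw i hi]

lemma cyc_card {V : Type} {k m ℓ : ℕ} (N : V → Fin k × Fin m → V) (B) (hB : B ∈ cyc N ℓ) :
    B.card = ℓ ∧ Set.InjOn Prod.fst (B : Set ((V × Fin k) × Fin m)) := by
  classical
  obtain ⟨v, p, hv, hp, hvi, hvp, rfl⟩ := hB
  constructor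
  · rw [pat, Finset.card_image_of_injOn, Finset.card_range]
    intro i hi j hj h
    simp at hi hj h
    exact hvi i j hi hj h.1.1
  · intro x hx y hy h
    simp only [pat, Finset.coe_image, Set.mem_image, Finset.coe_range, Set.mem_Iio] at hx hy
    obtain ⟨i, hi, rfl⟩ := hx
    obtain ⟨j, hj, rfl⟩ := hy
    simp at h
    rw [hvi i j hi hj h.1]

end Cycles

theorem directed_cycles_avoidable :
    ∀ ℓ : ℕ, 2 ≤ ℓ → ∃ d : ℕ → ℕ, ∀ (k : ℕ) (α : Type) (D : Digraph' α),
      D.verts.Nonempty → D.MinOutDegAtLeast (d k) →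
      ∃ D' : Digraph' α, D'.IsSubdigraph D ∧ D'.verts.Nonempty ∧
        D'.MinOutDegAtLeast k ∧ ¬ HasDirCycle D' ℓ := by
  classical
  intro ℓ hℓ
  refine ⟨fun k => k * (2 ^ ℓ * (k + 1) ^ (ℓ - 1)), fun k α D hne hD => ?_⟩
  set m := 2 ^ ℓ * (k + 1) ^ (ℓ - 1) with hm
  have hmpos : 0 < m := by positivity
  have hex : ∀ v : D.verts, ∃ g : Fin k × Fin m → D.verts, Function.Injective g ∧
      ∀ x, D.Adj v (g x) := by
    intro v
    obtain ⟨t, ht, hc⟩ := hD v.1 v.2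
    have : Fintype.card (Fin k × Fin m) ≤ Fintype.card t := by simpa using hc
    obtain ⟨e⟩ := Function.Embedding.nonempty_of_card_le this
    refine ⟨fun x => ⟨(e x).1, D.mem_verts_right (ht (e x).2)⟩, ?_, fun x => ht (e x).2⟩
    intro x y h
    apply e.injective
    apply Subtype.ext
    simpa using h
  choose N hN hAdj using hex
  obtain ⟨f, hf⟩ := lll (σ := D.verts × Fin k) (m := m) (ℓ := ℓ) (M := (k * m) ^ (ℓ - 1)) hmpos
    (by omega) (cyc N ℓ) (fun B hB => (cyc_card N B hB).1) (fun B hB => (cyc_card N B hB).2)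
    (fun s => by
      obtain ⟨F, hF, hFB⟩ := cyc_deg (ℓ := ℓ) (by omega) N hN s
      exact ⟨F, hF, fun B hB hs => hFB B hB hs⟩)
    (by
      calc (k * m) ^ (ℓ - 1) * 2 ^ ℓ = m ^ (ℓ - 1) * (2 ^ ℓ * k ^ (ℓ - 1)) := by
            rw [mul_pow]; ring
        _ ≤ m ^ (ℓ - 1) * m := by
            apply Nat.mul_le_mul_left
            rw [hm]
            apply Nat.mul_le_mul_left
            exact Nat.pow_le_pow_left (by omega) _
        _ = m ^ ℓ := by
            rw [← pow_succ]; congr 1; omega)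
  let D' : Digraph' α :=
    { verts := D.verts
      Adj := fun u v => ∃ (u' : D.verts) (j : Fin k), u'.1 = u ∧ (N u' (j, f (u', j))).1 = v
      ne_of_adj := by
        rintro u v ⟨u', j, rfl, rfl⟩
        exact D.ne_of_adj (hAdj u' _)
      mem_verts_left := by
        rintro u v ⟨u', j, rfl, rfl⟩
        exact u'.2
      mem_verts_right := by
        rintro u v ⟨u', j, rfl, rfl⟩
        exact Subtype.property _ }
  refine ⟨D', ⟨subset_rfl, ?_⟩, hne, ?_, ?_⟩
  · rintro u v ⟨u', j, rfl, rfl⟩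
    exact hAdj u' _
  · intro v hv
    refine ⟨Finset.univ.image fun j : Fin k => (N ⟨v, hv⟩ (j, f (⟨v, hv⟩, j))).1, ?_, ?_⟩
    · intro x hx
      simp only [Finset.coe_image, Set.mem_image] at hx
      obtain ⟨j, -, rfl⟩ := hx
      exact ⟨⟨v, hv⟩, j, rfl, rfl⟩
    · rw [Finset.card_image_of_injective]
      · simp
      · intro i j h
        have := hN _ (Subtype.ext h)
        exact congrArg Prod.fst this
  · rintro ⟨c, hc, hadj⟩
    have hlt : ∀ i, i % ℓ < ℓ := fun i => Nat.mod_lt _ (by omega)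
    have hcv : ∀ i, c (i % ℓ) ∈ D.verts := fun i => D'.mem_verts_left (hadj _ (hlt i))
    have hj : ∀ i : ℕ, ∃ j : Fin k, (N ⟨c (i % ℓ), hcv i⟩
        (j, f (⟨c (i % ℓ), hcv i⟩, j))).1 = c ((i + 1) % ℓ) := by
      intro i
      obtain ⟨u', j, hu, hj⟩ := hadj _ (hlt i)
      have : u' = ⟨c (i % ℓ), hcv i⟩ := Subtype.ext hu
      subst this
      refine ⟨j, ?_⟩
      rw [hj, Nat.mod_add_mod]
    have hj' : ∀ v : D.verts, ∃ j : Fin k, ∀ i : ℕ, c (i % ℓ) = v →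
        (N v (j, f (v, j))).1 = c ((i + 1) % ℓ) := by
      intro v
      by_cases h : ∃ i : ℕ, c (i % ℓ) = v
      · obtain ⟨i, hi⟩ := h
        have : v = ⟨c (i % ℓ), hcv i⟩ := Subtype.ext hi.symm
        subst this
        obtain ⟨j, h⟩ := hj i
        refine ⟨j, fun i' hi' => ?_⟩
        have h2 := hc _ _ (hlt i') (hlt i) hi'
        rw [h, ← Nat.mod_add_mod i', h2, Nat.mod_add_mod]
      · obtain ⟨j, -⟩ := hj 0
        exact ⟨j, fun i hi => absurd ⟨i, hi⟩ h⟩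
    choose J hJ using hj'
    let v : ℕ → D.verts := fun i => ⟨c (i % ℓ), hcv i⟩
    have hvper : ∀ i, v (i + ℓ) = v i := fun i => Subtype.ext (by simp [v])
    refine hf (pat ℓ v fun i => (J (v i), f (v i, J (v i)))) ⟨v, _, hvper, ?_, ?_, ?_, rfl⟩ ?_
    · intro i
      simp only [hvper]
    · intro i j hi hj h
      apply hc i j hi hj
      have := congrArg Subtype.val h
      simpa [v, Nat.mod_eq_of_lt hi, Nat.mod_eq_of_lt hj] using this
    · intro i
      exact Subtype.ext (hJ (v i) i rfl)
    · intro x hx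
      simp only [pat, Finset.mem_image] at hx
      obtain ⟨i, -, rfl⟩ := hx
      rfl
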